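/- Let K ≥ 2, let θ_1, …, θ_K be independent Gaussian random variables with θ_i ∼ N(μ̂_i, 1/N_i) for integers N_i ≥ 1, and let π maximize the M=2 ReMax objective J(π) = Σ_{i,j} π_i π_j E[max(θ_i, θ_j)] (with the diagonal convention E[max(θ_i, θ_i)] = μ̂_i) over the probability simplex Δ^{K-1}. Fix an arm j ≠ 1 and reals μ₁ > μ_j with gap Δ_j := μ₁ − μ_j, and let 0 < ε ≤ Δ_j/4. If μ̂_1 ≥ μ₁ − ε and μ̂_j ≤ μ_j + ε, then π_j·(Δ_j/4) ≤ (π_1 + 1)·(1/√π)·exp( −(μ̂_1 − μ̂_j)² / ( 2·(1/N_1 + 1/N_j) ) ). Moreover, if in addition N_1 ≤ N_j, then π_j·(Δ_j/4) ≤ π_1·(1/√π)·exp( −(μ̂_1 − μ̂_j)² / ( 2·(1/N_1 + 1/N_j) ) ). -/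

import Mathlib

open MeasureTheory ProbabilityTheory
open scoped NNReal

/-- The joint posterior: independent Gaussian coordinates `θ_i ∼ N(μ̂_i, 1/N_i)`. -/
noncomputable def gaussPosterior (K : ℕ) (μhat : Fin K → ℝ) (N : Fin K → ℕ) :
    Measure (Fin K → ℝ) :=
  Measure.pi fun i => gaussianReal (μhat i) ((N i : ℝ≥0))⁻¹

/-- The `M = 2` ReMax objective `J(π) = Σ_{i,j} π_i π_j E[max(θ_i, θ_j)]`, where a
repeated draw of the same arm reuses the same posterior sample (so the diagonal term is
`E[θ_i] = μ̂_i`). -/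
noncomputable def remaxJ2 (K : ℕ) (μhat : Fin K → ℝ) (N : Fin K → ℕ)
    (π : Fin K → ℝ) : ℝ :=
  ∫ θ, ∑ i, ∑ j, π i * π j * max (θ i) (θ j) ∂(gaussPosterior K μhat N)


lemma aux_first_order {K : ℕ} (M : Matrix (Fin K) (Fin K) ℝ) (hM : M.transpose = M)
    (p : Fin K → ℝ) (hp0 : ∀ i, 0 ≤ p i) (hp1 : ∑ i, p i = 1)
    (hmax : ∀ p' : Fin K → ℝ, (∀ i, 0 ≤ p' i) → (∑ i, p' i = 1) →
      p' ⬝ᵥ M.mulVec p' ≤ p ⬝ᵥ M.mulVec p)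
    (a j : Fin K) (hj : j ≠ a) (hpj : 0 < p j) :
    ∑ k, p k * (M a k - M j k) ≤ 0 := by
  set d : Fin K → ℝ := Pi.single a 1 - Pi.single j 1 with hd
  have hlin : d ⬝ᵥ M.mulVec p = ∑ k, p k * (M a k - M j k) := by
    rw [hd, sub_dotProduct, single_one_dotProduct, single_one_dotProduct]
    simp only [Matrix.mulVec, dotProduct]
    rw [← Finset.sum_sub_distrib]
    exact Finset.sum_congr rfl fun k _ => by ring
  have hsym : p ⬝ᵥ M.mulVec d = d ⬝ᵥ M.mulVec p := by
    rw [Matrix.dotProduct_mulVec, ← Matrix.mulVec_transpose, hM, dotProduct_comm]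
  rw [← hlin]
  set L := d ⬝ᵥ M.mulVec p
  set Q := d ⬝ᵥ M.mulVec d
  have key : ∀ t : ℝ, 0 < t → t ≤ p j → 2 * L + t * Q ≤ 0 := by
    intro t ht htj
    have h := hmax (p + t • d) ?_ ?_
    · have e : (p + t • d) ⬝ᵥ M.mulVec (p + t • d)
          = p ⬝ᵥ M.mulVec p + t * (2 * L + t * Q) := by
        simp only [Matrix.mulVec_add, Matrix.mulVec_smul, dotProduct_add, add_dotProduct,
          smul_dotProduct, dotProduct_smul, smul_eq_mul]
        rw [hsym]; ring
      rw [e] at h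
      by_contra hc
      push Not at hc
      have := mul_pos ht hc
      linarith
    · intro i
      simp only [hd, Pi.add_apply, Pi.smul_apply, Pi.sub_apply, smul_eq_mul, Pi.single_apply]
      have := hp0 i
      split_ifs with h1 h2 h2
      · simpa using this
      · linarith
      · subst h2; linarith
      · linarith
    · simp [hd, Finset.sum_add_distrib, ← Finset.mul_sum, hp1]
  by_contra hc
  push Not at hc
  by_cases hQ : 0 ≤ Q
  · have := key (p j) hpj le_rfl
    have := mul_nonneg hpj.le hQ
    linarith
  · push Not at hQ
    have h1 : 0 < L / (-Q) := div_pos hc (by linarith)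
    have := key (min (p j) (L / (-Q))) (lt_min hpj h1) (min_le_left _ _)
    have h2 : min (p j) (L / (-Q)) * (-Q) ≤ L / (-Q) * (-Q) :=
      mul_le_mul_of_nonneg_right (min_le_right _ _) (by linarith)
    rw [div_mul_cancel₀ _ (by linarith : (-Q) ≠ 0)] at h2
    linarith

lemma aux_gauss (v : NNReal) (hv : v ≠ 0) (hv2 : v ≤ 2) (d : ℝ) (hd : 0 ≤ d) :
    ∫ z, max z 0 ∂(gaussianReal (-d) v)
      ≤ 1 / Real.sqrt Real.pi * Real.exp (-d ^ 2 / (2 * (v : ℝ))) := by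
  have hv0 : (0 : ℝ) < v := by positivity
  have hv2' : (v : ℝ) ≤ 2 := by exact_mod_cast hv2
  rw [integral_gaussianReal_eq_integral_smul hv]
  rw [← setIntegral_eq_integral_of_forall_compl_eq_zero (s := Set.Ioi 0)
    (fun x hx => by
      have : x ≤ 0 := by simpa using hx
      simp [max_eq_right this])]
  set C : ℝ := (Real.sqrt (2 * Real.pi * v))⁻¹ * Real.exp (-d ^ 2 / (2 * (v : ℝ))) with hC
  have hb : (0 : ℝ) < 1 / (2 * v) := by positivity
  have hint : IntegrableOn (fun x : ℝ => C * (x * Real.exp (-(1 / (2 * v)) * x ^ 2)))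
      (Set.Ioi 0) := ((integrable_mul_exp_neg_mul_sq hb).const_mul C).integrableOn
  have hval : ∫ x in Set.Ioi (0 : ℝ), x * Real.exp (-(1 / (2 * (v : ℝ))) * x ^ 2) = v := by
    have := integral_rpow_mul_exp_neg_mul_rpow (p := 2) (q := 1) (by norm_num) (by norm_num) hb
    norm_num at this
    rw [Real.rpow_neg_one] at this
    norm_num at this ⊢
    rw [this]; field_simp
  have hle : ∀ x ∈ Set.Ioi (0 : ℝ), gaussianPDFReal (-d) v x • max x 0
      ≤ C * (x * Real.exp (-(1 / (2 * v)) * x ^ 2)) := by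
    intro x hx
    have hx : 0 < x := hx
    rw [max_eq_left hx.le, gaussianPDFReal, smul_eq_mul, hC]
    have : Real.exp (-(x - -d) ^ 2 / (2 * v)) ≤
        Real.exp (-d ^ 2 / (2 * (v : ℝ))) * Real.exp (-(1 / (2 * v)) * x ^ 2) := by
      rw [← Real.exp_add]
      apply Real.exp_le_exp.2
      have e : -d ^ 2 / (2 * (v : ℝ)) + -(1 / (2 * v)) * x ^ 2 = (-d^2 - x^2) / (2 * v) := by
        field_simp; ring
      rw [e]
      gcongr
      nlinarith [mul_nonneg hx.le hd]
    calc _ ≤ (Real.sqrt (2 * Real.pi * v))⁻¹ * (Real.exp (-d ^ 2 / (2 * (v : ℝ))) * Real.exp (-(1 / (2 * v)) * x ^ 2)) * x := by gcongr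
      _ = _ := by ring
  have hmono : ∫ x in Set.Ioi (0 : ℝ), gaussianPDFReal (-d) v x • max x 0 ≤
      ∫ x in Set.Ioi (0 : ℝ), C * (x * Real.exp (-(1 / (2 * (v : ℝ))) * x ^ 2)) := by
    apply integral_mono_of_nonneg
    · exact Filter.Eventually.of_forall fun x =>
        mul_nonneg (gaussianPDFReal_nonneg _ _ _) (le_max_right _ _)
    · exact hint
    · exact (ae_restrict_iff' measurableSet_Ioi).2 (Filter.Eventually.of_forall hle)
  refine hmono.trans ?_
  rw [integral_const_mul, hval, hC]
  have : (Real.sqrt (2 * Real.pi * v))⁻¹ * v ≤ 1 / Real.sqrt Real.pi := by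
    rw [inv_mul_eq_div, div_le_div_iff₀ (by positivity) (by positivity), one_mul]
    apply Real.le_sqrt_of_sq_le
    rw [mul_pow, Real.sq_sqrt Real.pi_pos.le]
    nlinarith [mul_pos Real.pi_pos hv0]
  calc _ = (Real.sqrt (2 * Real.pi * v))⁻¹ * v * Real.exp (-d ^ 2 / (2 * (v : ℝ))) := by ring
    _ ≤ _ := by gcongr

lemma aux_int_id (m : ℝ) (v : NNReal) : Integrable (fun x : ℝ => x) (gaussianReal m v) :=
  (memLp_id_gaussianReal (μ := m) (v := v) 1).integrable (by simp)

lemma aux_icx (m₁ m₂ : ℝ) (v₁ v₂ : NNReal) (hm : m₂ ≤ m₁) (hv : v₂ ≤ v₁) (x : ℝ) :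
    ∫ y, max y x ∂(gaussianReal m₂ v₂) ≤ ∫ y, max y x ∂(gaussianReal m₁ v₁) := by
  have e : gaussianReal m₁ v₁ = (gaussianReal m₂ v₂) ∗ (gaussianReal (m₁ - m₂) (v₁ - v₂)) := by
    rw [gaussianReal_conv_gaussianReal, add_sub_cancel, add_tsub_cancel_of_le hv]
  have hi : Integrable (fun y => max y x) (gaussianReal m₁ v₁) :=
    (aux_int_id _ _).sup (integrable_const x)
  have hi2 := hi
  rw [e] at hi
  rw [e, integral_conv hi]
  have hi' : Integrable (fun z : ℝ × ℝ => max (z.1 + z.2) x)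
      ((gaussianReal m₂ v₂).prod (gaussianReal (m₁ - m₂) (v₁ - v₂))) := by
    rw [Measure.conv] at hi
    exact (integrable_map_measure (by fun_prop) (by fun_prop)).1 hi
  refine integral_mono ((aux_int_id _ _).sup (integrable_const x)) hi'.integral_prod_left ?_
  intro y
  have hadd : Integrable (fun w : ℝ => y + w) (gaussianReal (m₁ - m₂) (v₁ - v₂)) :=
    (integrable_const y).add (aux_int_id _ _)
  have hm' : Integrable (fun w : ℝ => max (y + w) x) (gaussianReal (m₁ - m₂) (v₁ - v₂)) :=
    hadd.sup (integrable_const x)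
  apply max_le
  · have h := integral_mono hadd hm' fun w => le_max_left _ _
    rw [integral_add (integrable_const y) (aux_int_id _ _), integral_id_gaussianReal] at h
    simp only [integral_const, probReal_univ, one_smul] at h
    linarith
  · have h := integral_mono (integrable_const x) hm' fun w => le_max_right _ _
    simpa using h

section
variable {K : ℕ} (μhat : Fin K → ℝ) (N : Fin K → ℕ)

instance aux_prob : IsProbabilityMeasure (gaussPosterior K μhat N) := by
  unfold gaussPosterior; infer_instance

lemma aux_mp (i : Fin K) : MeasurePreserving (fun θ : Fin K → ℝ => θ i)
    (gaussPosterior K μhat N) (gaussianReal (μhat i) ((N i : NNReal))⁻¹) :=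
  measurePreserving_eval (fun i => gaussianReal (μhat i) ((N i : NNReal))⁻¹) i

lemma aux_int (i : Fin K) : Integrable (fun θ : Fin K → ℝ => θ i) (gaussPosterior K μhat N) :=
  (aux_mp μhat N i).integrable_comp_of_integrable (aux_int_id _ _)

lemma aux_mean (i : Fin K) : ∫ θ, θ i ∂(gaussPosterior K μhat N) = μhat i := by
  have h := (aux_mp μhat N i).map_eq
  have := integral_map (μ := gaussPosterior K μhat N) (φ := fun θ : Fin K → ℝ => θ i)
    (f := fun x : ℝ => x) (measurable_pi_apply i).aemeasurable (by fun_prop)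
  rw [← this, h, integral_id_gaussianReal]

lemma aux_indep {i k : Fin K} (h : i ≠ k) :
    IndepFun (fun θ : Fin K → ℝ => θ i) (fun θ : Fin K → ℝ => θ k) (gaussPosterior K μhat N) :=
  (iIndepFun_pi (μ := fun i => gaussianReal (μhat i) ((N i : NNReal))⁻¹)
    (X := fun _ => id) (fun _ => aemeasurable_id)).indepFun h

lemma aux_max {i k : Fin K} (h : i ≠ k) :
    ∫ θ, max (θ i) (θ k) ∂(gaussPosterior K μhat N) =
      ∫ x, ∫ y, max y x ∂(gaussianReal (μhat i) ((N i : NNReal))⁻¹)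
        ∂(gaussianReal (μhat k) ((N k : NNReal))⁻¹) ∧
    Integrable (fun x => ∫ y, max y x ∂(gaussianReal (μhat i) ((N i : NNReal))⁻¹))
      (gaussianReal (μhat k) ((N k : NNReal))⁻¹) := by
  have hm := (indepFun_iff_map_prod_eq_prod_map_map (measurable_pi_apply i).aemeasurable
    (measurable_pi_apply k).aemeasurable).1
    (aux_indep μhat N h)
  rw [(aux_mp μhat N i).map_eq, (aux_mp μhat N k).map_eq] at hm
  have hi : Integrable (fun z : ℝ × ℝ => max z.1 z.2)
      ((gaussianReal (μhat i) ((N i : NNReal))⁻¹).prod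
        (gaussianReal (μhat k) ((N k : NNReal))⁻¹)) := by
    rw [← hm]
    refine (integrable_map_measure (by fun_prop) (by fun_prop)).2 ?_
    exact (aux_int μhat N i).sup (aux_int μhat N k)
  refine ⟨?_, hi.integral_prod_right⟩
  rw [← integral_prod_symm _ hi, ← hm, integral_map (by fun_prop) (by fun_prop)]

lemma aux_EI {i k : Fin K} (h : i ≠ k) (hNi : 1 ≤ N i) (hNk : 1 ≤ N k)
    (hd : μhat i ≤ μhat k) :
    ∫ θ, max (θ i - θ k) 0 ∂(gaussPosterior K μhat N) ≤
      1 / Real.sqrt Real.pi * Real.exp (-(μhat k - μhat i) ^ 2 /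
              (2 * (1 / (N k : ℝ) + 1 / (N i : ℝ)))) := by
  have h1 : (gaussPosterior K μhat N).map (fun θ => - θ k) =
      gaussianReal (- μhat k) ((N k : NNReal))⁻¹ := by
    rw [← gaussianReal_map_neg, ← (aux_mp μhat N k).map_eq, Measure.map_map (by fun_prop) (by fun_prop)]
    rfl
  have h2 : (gaussPosterior K μhat N).map (fun θ => θ i + - θ k) =
      gaussianReal (μhat i + - μhat k) ((N i : NNReal)⁻¹ + (N k : NNReal)⁻¹) := 
    gaussianReal_add_gaussianReal_of_indepFun
      ((aux_indep μhat N h).comp measurable_id measurable_neg) (aux_mp μhat N i).map_eq h1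
  have e : μhat i + - μhat k = -(μhat k - μhat i) := by ring
  rw [e] at h2
  have h3 := aux_gauss ((N i : NNReal)⁻¹ + (N k : NNReal)⁻¹) (by positivity) (by
    have a1 : (N i : NNReal)⁻¹ ≤ 1 := inv_le_one_of_one_le₀ (by exact_mod_cast hNi)
    have a2 : (N k : NNReal)⁻¹ ≤ 1 := inv_le_one_of_one_le₀ (by exact_mod_cast hNk)
    calc _ ≤ (1 : NNReal) + 1 := add_le_add a1 a2
      _ = 2 := by norm_num) (μhat k - μhat i) (by linarith)
  rw [← h2, integral_map (by fun_prop) (by fun_prop)] at h3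
  simpa [sub_eq_add_neg, one_div, add_comm] using h3

end

/-- Upper bound on `π_j` at the ReMax optimum: if arm 1 is not underestimated and arm `j`
is not overestimated, then
`π_j (Δ_j/4) ≤ (π_1 + 1)(1/√π) exp(−(μ̂_1 − μ̂_j)²/(2(1/N_1 + 1/N_j)))`, and if moreover
`N_1 ≤ N_j`, then
`π_j (Δ_j/4) ≤ π_1 (1/√π) exp(−(μ̂_1 − μ̂_j)²/(2(1/N_1 + 1/N_j)))`. -/
theorem pi_j_upper_bound
    (K : ℕ) (hK : 2 ≤ K)
    (μhat : Fin K → ℝ) (N : Fin K → ℕ) (hN : ∀ i, 1 ≤ N i)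
    (π : Fin K → ℝ) (hπ0 : ∀ i, 0 ≤ π i) (hπ1 : ∑ i, π i = 1)
    (hmax : ∀ π' : Fin K → ℝ, (∀ i, 0 ≤ π' i) → (∑ i, π' i = 1) →
      remaxJ2 K μhat N π' ≤ remaxJ2 K μhat N π)
    (i1 : Fin K) (hi1 : (i1 : ℕ) = 0) (j : Fin K) (hj : j ≠ i1)
    (μ₁ μj : ℝ) (hgap : μj < μ₁)
    (ε : ℝ) (hε : 0 < ε) (hε' : ε ≤ (μ₁ - μj) / 4)
    (h1 : μ₁ - ε ≤ μhat i1) (hjv : μhat j ≤ μj + ε) :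
    π j * ((μ₁ - μj) / 4)
        ≤ (π i1 + 1) * (1 / Real.sqrt Real.pi) *
            Real.exp (-(μhat i1 - μhat j) ^ 2 /
              (2 * (1 / (N i1 : ℝ) + 1 / (N j : ℝ)))) ∧
    (N i1 ≤ N j →
      π j * ((μ₁ - μj) / 4)
        ≤ π i1 * (1 / Real.sqrt Real.pi) *
            Real.exp (-(μhat i1 - μhat j) ^ 2 /
              (2 * (1 / (N i1 : ℝ) + 1 / (N j : ℝ))))) := by
  set P := gaussPosterior K μhat N with hP
  set M : Matrix (Fin K) (Fin K) ℝ := Matrix.of fun i k => ∫ θ, max (θ i) (θ k) ∂P with hM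
  have hMapp : ∀ i k, M i k = ∫ θ, max (θ i) (θ k) ∂P := fun i k => rfl
  have hMT : M.transpose = M := by
    ext i k
    simp only [Matrix.transpose_apply, hMapp, max_comm]
  have hint : ∀ i, Integrable (fun θ : Fin K → ℝ => θ i) P := aux_int μhat N
  have hint2 : ∀ i k, Integrable (fun θ : Fin K → ℝ => max (θ i) (θ k)) P :=
    fun i k => (hint i).sup (hint k)
  have hJ : ∀ p, remaxJ2 K μhat N p = p ⬝ᵥ M.mulVec p := by
    intro p
    unfold remaxJ2
    rw [integral_finsetSum _ fun i _ => integrable_finsetSum _ fun k _ => (hint2 i k).const_mul _]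
    simp only [dotProduct, Matrix.mulVec, Finset.mul_sum]
    refine Finset.sum_congr rfl fun i _ => ?_
    rw [integral_finsetSum _ fun k _ => (hint2 i k).const_mul _]
    refine Finset.sum_congr rfl fun k _ => ?_
    rw [integral_const_mul, hMapp]; ring
  simp only [hJ] at hmax
  set B := 1 / Real.sqrt Real.pi * Real.exp (-(μhat i1 - μhat j) ^ 2 /
              (2 * (1 / (N i1 : ℝ) + 1 / (N j : ℝ)))) with hB
  have hB0 : 0 ≤ B := by positivity
  simp only [mul_assoc, ← hB]
  rcases (hπ0 j).eq_or_lt with hz | hpj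
  · rw [← hz, zero_mul]
    exact ⟨mul_nonneg (by linarith [hπ0 i1]) hB0, fun _ => mul_nonneg (hπ0 i1) hB0⟩
  have hfo := aux_first_order M hMT π hπ0 hπ1 hmax i1 j hj hpj
  have hEI := aux_EI μhat N hj (hN j) (hN i1) (by linarith)
  rw [← hP, ← hB] at hEI
  set E := ∫ θ, max (θ j - θ i1) 0 ∂P with hE
  have hintE : Integrable (fun θ : Fin K → ℝ => max (θ j - θ i1) 0) P :=
    ((hint j).sub (hint i1)).sup (integrable_const 0)
  have hE0 : 0 ≤ E := integral_nonneg fun θ => le_max_right _ _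
  have hk : ∀ k, -E ≤ M i1 k - M j k := by
    intro k
    rw [hMapp, hMapp, ← integral_sub (hint2 _ _) (hint2 _ _), hE, ← integral_neg]
    refine integral_mono hintE.neg ((hint2 _ _).sub (hint2 _ _)) fun θ => ?_
    simp only
    grind
  have hjj : μhat i1 - μhat j ≤ M i1 j - M j j := by
    rw [hMapp, hMapp, ← integral_sub (hint2 _ _) (hint2 _ _), ← aux_mean μhat N i1,
      ← aux_mean μhat N j, ← integral_sub (hint _) (hint _)]
    refine integral_mono ((hint _).sub (hint _)) ((hint2 _ _).sub (hint2 _ _)) fun θ => ?_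
    simp only
    grind
  have hδ : (μ₁ - μj) / 4 ≤ μhat i1 - μhat j := by linarith
  have hδ' : π j * ((μ₁ - μj) / 4) ≤ π j * (M i1 j - M j j) :=
    mul_le_mul_of_nonneg_left (hδ.trans hjj) hpj.le
  rw [← Finset.add_sum_erase _ _ (Finset.mem_univ j)] at hfo hπ1
  constructor
  · have h3 : ∑ k ∈ Finset.univ.erase j, π k * (-E) ≤
        ∑ k ∈ Finset.univ.erase j, π k * (M i1 k - M j k) :=
      Finset.sum_le_sum fun k _ => mul_le_mul_of_nonneg_left (hk k) (hπ0 k)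
    rw [← Finset.sum_mul] at h3
    have h4 : ∑ k ∈ Finset.univ.erase j, π k = 1 - π j := by linarith
    rw [h4] at h3
    have h5 := mul_nonneg hpj.le hE0
    have h6 := mul_nonneg (hπ0 i1) hB0
    linarith
  · intro hNN
    have h2 : i1 ∈ Finset.univ.erase j := Finset.mem_erase.2 ⟨hj.symm, Finset.mem_univ _⟩
    rw [← Finset.add_sum_erase _ _ h2] at hfo
    have h3 : 0 ≤ ∑ k ∈ (Finset.univ.erase j).erase i1, π k * (M i1 k - M j k) := by
      refine Finset.sum_nonneg fun k hk' => mul_nonneg (hπ0 k) (sub_nonneg.2 ?_)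
      simp only [Finset.mem_erase, Finset.mem_univ, and_true] at hk'
      obtain ⟨e1, i1'⟩ := aux_max μhat N (Ne.symm hk'.1)
      obtain ⟨e2, i2'⟩ := aux_max μhat N (Ne.symm hk'.2)
      rw [hMapp, hMapp, hP, e1, e2]
      refine integral_mono i2' i1' fun x => ?_
      have hpos : (0 : ℝ≥0) < (N i1 : ℝ≥0) := by exact_mod_cast hN i1
      exact aux_icx _ _ _ _ (by linarith) (inv_anti₀ hpos (by exact_mod_cast hNN)) x
    have h4 := mul_le_mul_of_nonneg_left (hk i1) (hπ0 i1)
    have h5 := mul_le_mul_of_nonneg_left hEI (hπ0 i1)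
    linarith
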